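/- Under the uniform local ℓ_p stability assumption and the stated conditions on α and γ, a nonempty compact set X ⊆ ℝ^n satisfies X ⊆ D̃ if and only if V(X) < ∞. -/

import Mathlib

open Metric Set Filter Topology TopologicalSpace ENNReal

noncomputable section

abbrev Euc (n : ℕ) : Type := EuclideanSpace ℝ (Fin n)

/-- Trajectory of the discrete-time uncertain system `x_{k+1} = f (x_k) (w_k)`. -/
def traj {n m : ℕ} (f : Euc n → Euc m → Euc n) (x : Euc n) (π : ℕ → Euc m) : ℕ → Euc n
  | 0 => x
  | k + 1 => f (traj f x π k) (π k)

/-- Reachable set of `X` at time `k` under disturbance signals taking values in `W`. -/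
def reach {n m : ℕ} (f : Euc n → Euc m → Euc n) (W : Set (Euc m)) (X : Set (Euc n)) (k : ℕ) :
    Set (Euc n) :=
  {y | ∃ x ∈ X, ∃ π : ℕ → Euc m, (∀ j, π j ∈ W) ∧ y = traj f x π k}

/-- The one-step set-valued map `F(X) = {f x w : x ∈ X, w ∈ W}`. -/
def Fmap {n m : ℕ} (f : Euc n → Euc m → Euc n) (W : Set (Euc m)) (X : Set (Euc n)) :
    Set (Euc n) :=
  Set.image2 f X W

/-- Asymmetric (directed) Hausdorff distance `sup_{x ∈ A} dist(x, B)`. -/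
def dHa {n : ℕ} (A B : Set (Euc n)) : ℝ := ⨆ x : A, Metric.infDist (x : Euc n) B

/-- Uniform local ℓ_p stability of the robust invariant set `𝒜` within the safe set `𝒳`. -/
structure LpStable {n m : ℕ} (f : Euc n → Euc m → Euc n) (W : Set (Euc m))
    (𝒳 𝒜 : Set (Euc n)) where
  r : ℝ
  M : ℝ
  p : ℝ
  lam : ℝ → ℕ → ℝ
  r_pos : 0 < r
  M_ge_one : 1 ≤ M
  p_pos : 0 < p
  lam_nonneg : ∀ s ∈ Set.Icc (0 : ℝ) r, ∀ k : ℕ, 0 ≤ lam s k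
  lam_cont : ∀ k : ℕ, ContinuousOn (fun s => lam s k) (Set.Icc (0 : ℝ) r)
  lam_mono : ∀ k : ℕ, MonotoneOn (fun s => lam s k) (Set.Icc (0 : ℝ) r)
  lam_zero : ∀ k : ℕ, lam 0 k = 0
  lam_anti : ∀ s ∈ Set.Icc (0 : ℝ) r, ∀ k l : ℕ, k ≤ l → lam s l ≤ lam s k
  lam_le_id : ∀ s ∈ Set.Icc (0 : ℝ) r, lam s 0 ≤ s
  lam_summable : Summable fun k : ℕ => lam r k ^ p
  stab : ∀ x ∈ 𝒳, Metric.infDist x 𝒜 ≤ r →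
    ∀ π : ℕ → Euc m, (∀ j, π j ∈ W) →
      ∀ k : ℕ, Metric.infDist (traj f x π k) 𝒜 ≤ M * lam (Metric.infDist x 𝒜) k

/-- The safe robust domain of uniform attraction. -/
def DOUA {n m : ℕ} (f : Euc n → Euc m → Euc n) (W : Set (Euc m)) (𝒳 𝒜 : Set (Euc n)) :
    Set (Euc n) :=
  {x | (∀ k : ℕ, reach f W {x} k ⊆ 𝒳) ∧
    Filter.Tendsto (fun k => dHa (reach f W {x} k) 𝒜) Filter.atTop (nhds 0)}

/-- The safe robust domain of attraction. -/
def DOA {n m : ℕ} (f : Euc n → Euc m → Euc n) (W : Set (Euc m)) (𝒳 𝒜 : Set (Euc n)) :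
    Set (Euc n) :=
  {x | ∀ π : ℕ → Euc m, (∀ j, π j ∈ W) →
    (∀ k : ℕ, traj f x π k ∈ 𝒳) ∧
      Filter.Tendsto (fun k => Metric.infDist (traj f x π k) 𝒜) Filter.atTop (nhds 0)}

/-- `Ψ(X) = (sup_{y∈X} γ y) * (sup_{y∈X} α y)`. -/
def Psi {n : ℕ} (α : Euc n → ℝ) (γ : Euc n → ℝ≥0∞) (X : Set (Euc n)) : ℝ≥0∞ :=
  (⨆ y : X, γ (y : Euc n)) * ENNReal.ofReal (⨆ y : X, α (y : Euc n))

/-- The value function `V(X) = Σ_k Ψ(R(X,k))`. -/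
def Vval {n m : ℕ} (f : Euc n → Euc m → Euc n) (W : Set (Euc m)) (α : Euc n → ℝ)
    (γ : Euc n → ℝ≥0∞) (X : Set (Euc n)) : ℝ≥0∞ :=
  ∑' k : ℕ, Psi α γ (reach f W X k)

/-- `exp(-a)` for `a ∈ [0,∞]`, with `exp(-∞) = 0`. -/
def expNeg (a : ℝ≥0∞) : ℝ := if a = ⊤ then 0 else Real.exp (-a.toReal)

/-- The value function `W(X) = 1 - exp(-V(X))`. -/
def Wval {n m : ℕ} (f : Euc n → Euc m → Euc n) (W : Set (Euc m)) (α : Euc n → ℝ)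
    (γ : Euc n → ℝ≥0∞) (X : Set (Euc n)) : ℝ :=
  1 - expNeg (Vval f W α γ X)

/-- `ξ(X) = 1 - exp(-Ψ(X))`. -/
def xival {n : ℕ} (α : Euc n → ℝ) (γ : Euc n → ℝ≥0∞) (X : Set (Euc n)) : ℝ :=
  1 - expNeg (Psi α γ X)

/-- `β(X) = exp(Ψ(X)) - 1`. -/
def betaval {n : ℕ} (α : Euc n → ℝ) (γ : Euc n → ℝ≥0∞) (X : Set (Euc n)) : ℝ :=
  Real.exp ((Psi α γ X).toReal) - 1

/-- Conditions on `α`: continuous with `α̲ dist(x,𝒜)^p̄ ≤ α(x) ≤ ᾱ dist(x,𝒜)^p̄`. -/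
def AlphaHyp {n : ℕ} (𝒜 : Set (Euc n)) (α : Euc n → ℝ) (αlow αup pbar : ℝ) : Prop :=
  Continuous α ∧ 0 < αlow ∧ αlow ≤ αup ∧
    ∀ x : Euc n, αlow * Metric.infDist x 𝒜 ^ pbar ≤ α x ∧
      α x ≤ αup * Metric.infDist x 𝒜 ^ pbar

/-- Conditions on `γ`: finite, continuous and `≥ γ̲ > 0` on `𝒳`, `= ∞` outside `𝒳`,
blowing up along sequences converging to the boundary of `𝒳`. -/
def GammaHyp {n : ℕ} (𝒳 : Set (Euc n)) (γ : Euc n → ℝ≥0∞) (γlow : ℝ) : Prop :=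
  (∀ x ∈ 𝒳, γ x ≠ ⊤) ∧ ContinuousOn γ 𝒳 ∧ 0 < γlow ∧
    (∀ x ∈ 𝒳, ENNReal.ofReal γlow ≤ γ x) ∧
    (∀ x ∉ 𝒳, γ x = ⊤) ∧
    ∀ (u : ℕ → Euc n) (x : Euc n), x ∈ frontier 𝒳 →
      Filter.Tendsto u Filter.atTop (nhds x) →
      Filter.Tendsto (fun k => γ (u k)) Filter.atTop (nhds ⊤)

theorem traj_cont {n m : ℕ} (f : Euc n → Euc m → Euc n)
    (hf : Continuous fun p : Euc n × Euc m => f p.1 p.2) (k : ℕ) :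
    Continuous fun q : Euc n × (ℕ → Euc m) => traj f q.1 q.2 k := by
  induction k with
  | zero => exact continuous_fst
  | succ k ih =>
    have h2 : Continuous fun q : Euc n × (ℕ → Euc m) => q.2 k :=
      (continuous_apply k).comp continuous_snd
    exact hf.comp (ih.prodMk h2)

theorem traj_add {n m : ℕ} (f : Euc n → Euc m → Euc n) (x : Euc n) (π : ℕ → Euc m) (j k : ℕ) :
    traj f x π (j + k) = traj f (traj f x π j) (fun i => π (j + i)) k := by
  induction k with
  | zero => rfl
  | succ k ih =>
    change f (traj f x π (j + k)) (π (j + k)) = _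
    rw [ih]
    rfl

theorem sig_compact {m : ℕ} {W : Set (Euc m)} (hW : IsCompact W) :
    IsCompact {π : ℕ → Euc m | ∀ j, π j ∈ W} := by
  have h := isCompact_univ_pi (fun _ : ℕ => hW)
  convert h using 1
  ext π
  simp

theorem reach_compact {n m : ℕ} (f : Euc n → Euc m → Euc n)
    (hf : Continuous fun p : Euc n × Euc m => f p.1 p.2) {W : Set (Euc m)} (hW : IsCompact W)
    {X : Set (Euc n)} (hX : IsCompact X) (k : ℕ) : IsCompact (reach f W X k) := by
  have h := (hX.prod (sig_compact hW)).image (traj_cont f hf k)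
  convert h using 1
  ext y
  constructor
  · rintro ⟨x, hx, π, hπ, rfl⟩
    exact ⟨(x, π), ⟨hx, hπ⟩, rfl⟩
  · rintro ⟨⟨x, π⟩, ⟨hx, hπ⟩, rfl⟩
    exact ⟨x, hx, π, hπ, rfl⟩

theorem le_Psi {n : ℕ} {α : Euc n → ℝ} (hα : Continuous α) (γ : Euc n → ℝ≥0∞) {S : Set (Euc n)}
    (hS : IsCompact S) {y : Euc n} (hy : y ∈ S) :
    γ y * ENNReal.ofReal (α y) ≤ Psi α γ S := by
  unfold Psi
  have hb : BddAbove (Set.range fun y : S => α y) := by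
    obtain ⟨B, hB⟩ := hS.bddAbove_image hα.continuousOn
    refine ⟨B, ?_⟩
    rintro _ ⟨z, rfl⟩
    exact hB ⟨z, z.2, rfl⟩
  have h1 : γ y ≤ ⨆ z : S, γ (z : Euc n) := le_iSup (fun z : S => γ (z : Euc n)) ⟨y, hy⟩
  have h2 : α y ≤ ⨆ z : S, α (z : Euc n) := le_ciSup hb ⟨y, hy⟩
  exact mul_le_mul' h1 (ENNReal.ofReal_le_ofReal h2)

theorem gamma_bdd {n : ℕ} {𝒳 : Set (Euc n)} {γ : Euc n → ℝ≥0∞} {γlow : ℝ}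
    (hγ : GammaHyp 𝒳 γ γlow) {S : Set (Euc n)} (hS : IsCompact S) (hS𝒳 : S ⊆ 𝒳) :
    ∃ G : ℝ≥0∞, G ≠ ⊤ ∧ ∀ y ∈ S, γ y ≤ G := by
  rcases S.eq_empty_or_nonempty with rfl | hne
  · exact ⟨0, by simp, by simp⟩
  · obtain ⟨z, hz, hmax⟩ := hS.exists_isMaxOn hne (hγ.2.1.mono hS𝒳)
    exact ⟨γ z, hγ.1 z (hS𝒳 hz), fun y hy => hmax hy⟩

theorem Psi_le {n : ℕ} {α : Euc n → ℝ} {γ : Euc n → ℝ≥0∞} {S : Set (Euc n)} {G : ℝ≥0∞} {B : ℝ}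
    (hB0 : 0 ≤ B) (hG : ∀ y ∈ S, γ y ≤ G) (hB : ∀ y ∈ S, α y ≤ B) :
    Psi α γ S ≤ G * ENNReal.ofReal B := by
  unfold Psi
  exact mul_le_mul' (iSup_le fun y => hG y y.2)
    (ENNReal.ofReal_le_ofReal (Real.iSup_le (fun y => hB y y.2) hB0))

theorem backward {n m : ℕ}
    (f : Euc n → Euc m → Euc n) (hf : Continuous fun p : Euc n × Euc m => f p.1 p.2)
    (Wd : Set (Euc m)) (hWc : IsCompact Wd)
    (𝒳 : Set (Euc n))
    (𝒜 : Set (Euc n)) (h𝒜ne : 𝒜.Nonempty) (h𝒜c : IsCompact 𝒜) (h𝒜𝒳 : 𝒜 ⊆ 𝒳)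
    (α : Euc n → ℝ) (αlow αup pbar : ℝ) (hα : AlphaHyp 𝒜 α αlow αup pbar)
    (hpbar : 0 < pbar)
    (γ : Euc n → ℝ≥0∞) (γlow : ℝ) (hγ : GammaHyp 𝒳 γ γlow)
    (X : Set (Euc n)) (hXc : IsCompact X) (hV : Vval f Wd α γ X < ⊤) :
    X ⊆ DOUA f Wd 𝒳 𝒜 := by
  obtain ⟨hαc, hαl, hαlu, hαb⟩ := hα
  obtain ⟨hγfin, hγc, hγl, hγlow, hγtop, -⟩ := hγ
  have hR := reach_compact f hf hWc hXc
  have hsub : ∀ k, reach f Wd X k ⊆ 𝒳 := by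
    intro k y hy
    by_contra hyX
    have hd : 0 < infDist y 𝒜 :=
      (h𝒜c.isClosed.notMem_iff_infDist_pos h𝒜ne).1 fun h => hyX (h𝒜𝒳 h)
    have hpos : 0 < α y :=
      lt_of_lt_of_le (mul_pos hαl (Real.rpow_pos_of_pos hd _)) (hαb y).1
    have h1 := le_Psi hαc γ (hR k) hy
    rw [hγtop y hyX, ENNReal.top_mul (by simpa using hpos)] at h1
    have h2 : Psi α γ (reach f Wd X k) ≤ Vval f Wd α γ X := ENNReal.le_tsum k
    exact absurd (h1.trans h2) (not_le.2 hV)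
  have hmono : ∀ x ∈ X, ∀ k, reach f Wd {x} k ⊆ reach f Wd X k := by
    rintro x hx k y ⟨x', hx', π, hπ, rfl⟩
    rw [Set.mem_singleton_iff] at hx'
    subst hx'
    exact ⟨x', hx, π, hπ, rfl⟩
  have htend := ENNReal.tendsto_atTop_zero_of_tsum_ne_top (f := fun k => Psi α γ (reach f Wd X k)) hV.ne
  intro x hx
  refine ⟨fun k => (hmono x hx k).trans (hsub k), ?_⟩
  rw [Metric.tendsto_atTop]
  intro ε hε
  have hε2 : 0 < ε / 2 := by positivity
  have hc : 0 < γlow * (αlow * (ε / 2) ^ pbar) :=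
    mul_pos hγl (mul_pos hαl (Real.rpow_pos_of_pos hε2 _))
  have hev := htend.eventually_lt_const (show (0 : ℝ≥0∞) < ENNReal.ofReal (γlow * (αlow * (ε / 2) ^ pbar)) by
    simpa using hc)
  obtain ⟨N, hN⟩ := eventually_atTop.1 hev
  refine ⟨N, fun k hk => ?_⟩
  have h0 : 0 ≤ dHa (reach f Wd {x} k) 𝒜 := Real.iSup_nonneg fun _ => infDist_nonneg
  rw [Real.dist_eq, sub_zero, abs_of_nonneg h0]
  refine lt_of_le_of_lt (Real.iSup_le (fun y => ?_) hε2.le) (half_lt_self hε)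
  have hy := hmono x hx k y.2
  have h1 := le_Psi hαc γ (hR k) hy
  have h2 : ENNReal.ofReal (γlow * α y) ≤ γ y * ENNReal.ofReal (α y) := by
    rw [ENNReal.ofReal_mul hγl.le]
    exact mul_le_mul' (hγlow _ (hsub k hy)) le_rfl
  have h3 := (ENNReal.ofReal_lt_ofReal_iff hc).1 ((h2.trans h1).trans_lt (hN k hk))
  have h4 : α y < αlow * (ε / 2) ^ pbar := lt_of_mul_lt_mul_left h3 hγl.le
  have h5 := lt_of_mul_lt_mul_left ((hαb y).1.trans_lt h4) hαl.le
  exact ((Real.rpow_lt_rpow_iff infDist_nonneg hε2.le hpbar).1 h5).le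

theorem forward {n m : ℕ}
    (f : Euc n → Euc m → Euc n) (hf : Continuous fun p : Euc n × Euc m => f p.1 p.2)
    (Wd : Set (Euc m)) (hWc : IsCompact Wd)
    (𝒳 : Set (Euc n)) (h𝒳 : IsOpen 𝒳)
    (𝒜 : Set (Euc n)) (h𝒜ne : 𝒜.Nonempty) (h𝒜c : IsCompact 𝒜) (h𝒜𝒳 : 𝒜 ⊆ 𝒳)
    (H : LpStable f Wd 𝒳 𝒜)
    (α : Euc n → ℝ) (αlow αup pbar : ℝ) (hα : AlphaHyp 𝒜 α αlow αup pbar)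
    (hpbar : H.p ≤ pbar)
    (γ : Euc n → ℝ≥0∞) (γlow : ℝ) (hγ : GammaHyp 𝒳 γ γlow)
    (X : Set (Euc n)) (hXc : IsCompact X) (hX : X ⊆ DOUA f Wd 𝒳 𝒜) :
    Vval f Wd α γ X < ⊤ := by
  obtain ⟨hαc, hαl, hαlu, hαb⟩ := hα
  have hM := H.M_ge_one
  have hM0 : 0 < H.M := by linarith
  have hr := H.r_pos
  have hp := H.p_pos
  have hR := reach_compact f hf hWc hXc
  have hsub : ∀ k, reach f Wd X k ⊆ 𝒳 := by
    rintro k y ⟨x, hx, π, hπ, rfl⟩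
    exact (hX hx).1 k ⟨x, rfl, π, hπ, rfl⟩
  obtain ⟨r₀, hr₀, hr₀X⟩ := h𝒜c.exists_cthickening_subset_open h𝒳 h𝒜𝒳
  obtain ⟨G, hGtop, hG⟩ := gamma_bdd hγ (h𝒜c.cthickening (r := r₀)) hr₀X
  have hthick : ∀ y, infDist y 𝒜 ≤ r₀ → y ∈ cthickening r₀ 𝒜 := by
    intro y hy
    rw [mem_cthickening_iff, ← ENNReal.ofReal_toReal (infEDist_ne_top h𝒜ne)]
    exact ENNReal.ofReal_le_ofReal hy
  set δ : ℝ := min r₀ H.r / H.M with hδ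
  have hδ0 : 0 < δ := div_pos (lt_min hr₀ hr) hM0
  have hδM : H.M * δ = min r₀ H.r := by rw [hδ]; field_simp
  have hδle : δ ≤ min r₀ H.r := by rw [← hδM]; nlinarith
  have hδr : δ ≤ H.r := hδle.trans (min_le_right _ _)
  -- uniform hitting time
  have hK : ∃ K : ℕ, ∀ x ∈ X, ∀ π : ℕ → Euc m, (∀ j, π j ∈ Wd) →
      ∃ j ≤ K, infDist (traj f x π j) 𝒜 ≤ δ := by
    refine hXc.induction_on (p := fun s => ∃ K : ℕ, ∀ x ∈ s, ∀ π : ℕ → Euc m, (∀ j, π j ∈ Wd) →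
      ∃ j ≤ K, infDist (traj f x π j) 𝒜 ≤ δ) ⟨0, by simp⟩ ?_ ?_ ?_
    · rintro s t hst ⟨K, hK⟩
      exact ⟨K, fun x hx => hK x (hst hx)⟩
    · rintro s t ⟨K, hK⟩ ⟨L, hL⟩
      refine ⟨max K L, ?_⟩
      rintro x (hx | hx) π hπ
      · obtain ⟨j, hj, h⟩ := hK x hx π hπ
        exact ⟨j, hj.trans (le_max_left _ _), h⟩
      · obtain ⟨j, hj, h⟩ := hL x hx π hπ
        exact ⟨j, hj.trans (le_max_right _ _), h⟩
    · intro x hx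
      obtain ⟨k, hk⟩ := ((hX hx).2.eventually_lt_const hδ0).exists
      have hlt : ∀ π ∈ {π : ℕ → Euc m | ∀ j, π j ∈ Wd}, infDist (traj f x π k) 𝒜 < δ := by
        intro π hπ
        refine lt_of_le_of_lt ?_ hk
        have hc := reach_compact f hf hWc (isCompact_singleton (x := x)) k
        obtain ⟨B, hB⟩ := hc.bddAbove_image (continuous_infDist_pt 𝒜).continuousOn
        refine le_ciSup (f := fun z : reach f Wd {x} k => infDist (z : Euc n) 𝒜) ⟨B, ?_⟩
          ⟨traj f x π k, x, rfl, π, hπ, rfl⟩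
        rintro _ ⟨z, rfl⟩
        exact hB ⟨z, z.2, rfl⟩
      have hev : ∀ᶠ x' in 𝓝 x, ∀ π ∈ {π : ℕ → Euc m | ∀ j, π j ∈ Wd},
          infDist (traj f x' π k) 𝒜 < δ := by
        refine (sig_compact hWc).eventually_forall_of_forall_eventually fun π hπ => ?_
        have hcont : Continuous fun q : Euc n × (ℕ → Euc m) => infDist (traj f q.1 q.2 k) 𝒜 :=
          (continuous_infDist_pt 𝒜).comp (traj_cont f hf k)
        exact hcont.continuousAt.eventually_lt_const (hlt π hπ)
      exact ⟨_, mem_nhdsWithin_of_mem_nhds hev, k, fun x' hx' π hπ => ⟨k, le_rfl, (hx' π hπ).le⟩⟩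
  obtain ⟨K, hK⟩ := hK
  have hrmem : H.r ∈ Set.Icc (0 : ℝ) H.r := ⟨hr.le, le_rfl⟩
  have hδmem : δ ∈ Set.Icc (0 : ℝ) H.r := ⟨hδ0.le, hδr⟩
  have hbound : ∀ i, ∀ y ∈ reach f Wd X (i + K),
      infDist y 𝒜 ≤ r₀ ∧ infDist y 𝒜 ≤ H.M * H.lam H.r i := by
    rintro i y ⟨x, hx, π, hπ, rfl⟩
    obtain ⟨j, hj, hjd⟩ := hK x hx π hπ
    obtain ⟨l, rfl⟩ := Nat.exists_eq_add_of_le hj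
    have hz : traj f x π j ∈ 𝒳 := hsub j ⟨x, hx, π, hπ, rfl⟩
    have hst := H.stab _ hz (hjd.trans hδr) (fun i => π (j + i)) (fun _ => hπ _) (l + i)
    rw [show i + (j + l) = j + (l + i) by ring, traj_add]
    have hdm : infDist (traj f x π j) 𝒜 ∈ Set.Icc (0 : ℝ) H.r := ⟨infDist_nonneg, hjd.trans hδr⟩
    constructor
    · have h1 := H.lam_anti _ hdm 0 (l + i) (Nat.zero_le _)
      have h2 := H.lam_le_id _ hdm
      have h3 : H.M * H.lam (infDist (traj f x π j) 𝒜) (l + i) ≤ H.M * δ :=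
        mul_le_mul_of_nonneg_left (by linarith) hM0.le
      rw [hδM] at h3
      exact (hst.trans h3).trans (min_le_left _ _)
    · have h1 := H.lam_anti _ hdm i (l + i) (by omega)
      have h2 : H.lam (infDist (traj f x π j) 𝒜) i ≤ H.lam H.r i :=
        H.lam_mono i hdm hrmem hdm.2
      exact hst.trans (mul_le_mul_of_nonneg_left (by linarith) hM0.le)
  have hαup : 0 ≤ αup := by linarith
  have hpb : 0 ≤ pbar := by linarith
  set C : ℝ := αup * (H.M ^ pbar * H.r ^ (pbar - H.p)) with hC
  have hC0 : 0 ≤ C := by positivity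
  have htail : ∀ i, Psi α γ (reach f Wd X (i + K)) ≤ G * ENNReal.ofReal (C * H.lam H.r i ^ H.p) := by
    intro i
    have hl0 := H.lam_nonneg _ hrmem i
    have hlr : H.lam H.r i ≤ H.r := (H.lam_anti _ hrmem 0 i (Nat.zero_le _)).trans (H.lam_le_id _ hrmem)
    refine Psi_le (mul_nonneg hC0 (Real.rpow_nonneg hl0 _))
      (fun y hy => hG y (hthick y (hbound i y hy).1)) fun y hy => ?_
    refine (hαb y).2.trans ?_
    rw [hC, mul_assoc]
    refine mul_le_mul_of_nonneg_left ?_ hαup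
    refine (Real.rpow_le_rpow infDist_nonneg (hbound i y hy).2 hpb).trans ?_
    rw [Real.mul_rpow hM0.le hl0, mul_assoc]
    refine mul_le_mul_of_nonneg_left ?_ (Real.rpow_nonneg hM0.le _)
    have he : H.lam H.r i ^ pbar = H.lam H.r i ^ (pbar - H.p) * H.lam H.r i ^ H.p := by
      rw [← Real.rpow_add_of_nonneg hl0 (by linarith) hp.le]
      congr 1
      ring
    rw [he]
    exact mul_le_mul_of_nonneg_right (Real.rpow_le_rpow hl0 hlr (by linarith))
      (Real.rpow_nonneg hl0 _)
  have hfin : ∀ k, Psi α γ (reach f Wd X k) < ⊤ := by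
    intro k
    obtain ⟨G', hG't, hG'⟩ := gamma_bdd hγ (hR k) (hsub k)
    obtain ⟨B, hB⟩ := (hR k).bddAbove_image hαc.continuousOn
    refine (Psi_le (le_max_right B 0) hG'
      (fun y hy => (hB ⟨y, hy, rfl⟩).trans (le_max_left _ _))).trans_lt ?_
    exact ENNReal.mul_lt_top hG't.lt_top ENNReal.ofReal_lt_top
  unfold Vval
  rw [← ENNReal.summable.sum_add_tsum_nat_add' (k := K)]
  refine ENNReal.add_lt_top.2 ⟨ENNReal.sum_lt_top.2 fun k _ => hfin k, ?_⟩
  refine (ENNReal.tsum_le_tsum htail).trans_lt ?_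
  rw [ENNReal.tsum_mul_left]
  refine ENNReal.mul_lt_top hGtop.lt_top ?_
  exact (H.lam_summable.mul_left C).tsum_ofReal_lt_top

theorem stmt9 {n m : ℕ}
    (f : Euc n → Euc m → Euc n) (hf : Continuous fun p : Euc n × Euc m => f p.1 p.2)
    (Wd : Set (Euc m)) (hWne : Wd.Nonempty) (hWc : IsCompact Wd)
    (𝒳 : Set (Euc n)) (h𝒳 : IsOpen 𝒳)
    (𝒜 : Set (Euc n)) (h𝒜ne : 𝒜.Nonempty) (h𝒜c : IsCompact 𝒜) (h𝒜𝒳 : 𝒜 ⊆ 𝒳)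
    (h𝒜inv : ∀ x ∈ 𝒜, ∀ w ∈ Wd, f x w ∈ 𝒜)
    (H : LpStable f Wd 𝒳 𝒜)
    (α : Euc n → ℝ) (αlow αup pbar : ℝ) (hα : AlphaHyp 𝒜 α αlow αup pbar)
    (hpbar : H.p ≤ pbar)
    (γ : Euc n → ℝ≥0∞) (γlow : ℝ) (hγ : GammaHyp 𝒳 γ γlow)
    (X : Set (Euc n)) (hXne : X.Nonempty) (hXc : IsCompact X) :
    X ⊆ DOUA f Wd 𝒳 𝒜 ↔ Vval f Wd α γ X < ⊤ := by
  constructor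
  · exact forward f hf Wd hWc 𝒳 h𝒳 𝒜 h𝒜ne h𝒜c h𝒜𝒳 H α αlow αup pbar hα hpbar γ γlow hγ X hXc
  · exact backward f hf Wd hWc 𝒳 𝒜 h𝒜ne h𝒜c h𝒜𝒳 α αlow αup pbar hα
      (lt_of_lt_of_le H.p_pos hpbar) γ γlow hγ X hXc


end
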